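/- Let T be a continuous t-norm on [0,1] and S a continuous t-conorm on [0,1]. Then for every u ∈ [0,1] and all reals t₁, t₂ > 0, T(u_T^(t₁), u_T^(t₂)) = u_T^(t₁+t₂) and S(u_S^(t₁), u_S^(t₂)) = u_S^(t₁+t₂). In particular, t ↦ u_T^(t) is nonincreasing on (0,∞) and t ↦ u_S^(t) is nondecreasing on (0,∞). -/

import Mathlib

open Set

/-- A t-norm on `[0,1]`: commutative, associative, nondecreasing in each argument,
with neutral element `1`. -/
structure IsTnorm (T : ℝ → ℝ → ℝ) : Prop where
  maps_to : ∀ x ∈ Icc (0:ℝ) 1, ∀ y ∈ Icc (0:ℝ) 1, T x y ∈ Icc (0:ℝ) 1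
  comm : ∀ x ∈ Icc (0:ℝ) 1, ∀ y ∈ Icc (0:ℝ) 1, T x y = T y x
  assoc : ∀ x ∈ Icc (0:ℝ) 1, ∀ y ∈ Icc (0:ℝ) 1, ∀ z ∈ Icc (0:ℝ) 1,
    T (T x y) z = T x (T y z)
  mono : ∀ x ∈ Icc (0:ℝ) 1, ∀ y ∈ Icc (0:ℝ) 1, ∀ z ∈ Icc (0:ℝ) 1,
    y ≤ z → T x y ≤ T x z
  one : ∀ x ∈ Icc (0:ℝ) 1, T x 1 = x

/-- A t-conorm on `[0,1]`: commutative, associative, nondecreasing in each argument,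
with neutral element `0`. -/
structure IsTconorm (S : ℝ → ℝ → ℝ) : Prop where
  maps_to : ∀ x ∈ Icc (0:ℝ) 1, ∀ y ∈ Icc (0:ℝ) 1, S x y ∈ Icc (0:ℝ) 1
  comm : ∀ x ∈ Icc (0:ℝ) 1, ∀ y ∈ Icc (0:ℝ) 1, S x y = S y x
  assoc : ∀ x ∈ Icc (0:ℝ) 1, ∀ y ∈ Icc (0:ℝ) 1, ∀ z ∈ Icc (0:ℝ) 1,
    S (S x y) z = S x (S y z)
  mono : ∀ x ∈ Icc (0:ℝ) 1, ∀ y ∈ Icc (0:ℝ) 1, ∀ z ∈ Icc (0:ℝ) 1,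
    y ≤ z → S x y ≤ S x z
  zero : ∀ x ∈ Icc (0:ℝ) 1, S x 0 = x

/-- Continuity of a binary operation on the unit square. -/
def ContinuousOn2 (T : ℝ → ℝ → ℝ) : Prop :=
  ContinuousOn (fun p : ℝ × ℝ => T p.1 p.2) (Icc (0:ℝ) 1 ×ˢ Icc (0:ℝ) 1)

/-- `n`-fold power `u_T^(n)` with respect to a t-norm: `u_T^(0) = 1`,
`u_T^(n+1) = T (u_T^(n)) u`. -/
def Tpow (T : ℝ → ℝ → ℝ) (u : ℝ) : ℕ → ℝ
  | 0 => 1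
  | n + 1 => T (Tpow T u n) u

/-- `n`-fold power `u_S^(n)` with respect to a t-conorm: `u_S^(0) = 0`,
`u_S^(n+1) = S (u_S^(n)) u`. -/
def Spow (S : ℝ → ℝ → ℝ) (u : ℝ) : ℕ → ℝ
  | 0 => 0
  | n + 1 => S (Spow S u n) u

/-- `p`-th root `u_T^(1/p) = sup {v ∈ [0,1] | v_T^(p) < u}`. -/
noncomputable def Troot (T : ℝ → ℝ → ℝ) (u : ℝ) (p : ℕ) : ℝ :=
  sSup {v ∈ Icc (0:ℝ) 1 | Tpow T v p < u}

/-- `p`-th root `u_S^(1/p) = inf {v ∈ [0,1] | v_S^(p) > u}`. -/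
noncomputable def Sroot (S : ℝ → ℝ → ℝ) (u : ℝ) (p : ℕ) : ℝ :=
  sInf {v ∈ Icc (0:ℝ) 1 | u < Spow S v p}

/-- Rational power `u_T^(q/p) = (u_T^(1/p))_T^(q)`, with `r = q/p` in lowest terms. -/
noncomputable def TratPow (T : ℝ → ℝ → ℝ) (u : ℝ) (r : ℚ) : ℝ :=
  Tpow T (Troot T u r.den) r.num.toNat

/-- Rational power `u_S^(q/p) = (u_S^(1/p))_S^(q)`, with `r = q/p` in lowest terms. -/
noncomputable def SratPow (S : ℝ → ℝ → ℝ) (u : ℝ) (r : ℚ) : ℝ :=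
  Spow S (Sroot S u r.den) r.num.toNat

/-- Real power `u_T^(t) = inf {u_T^(r) | r ∈ [0,t] ∩ ℚ}`. -/
noncomputable def TrePow (T : ℝ → ℝ → ℝ) (u : ℝ) (t : ℝ) : ℝ :=
  sInf (TratPow T u '' {r : ℚ | 0 ≤ r ∧ (r : ℝ) ≤ t})

/-- Real power `u_S^(t) = sup {u_S^(r) | r ∈ [0,t] ∩ ℚ}`. -/
noncomputable def SrePow (S : ℝ → ℝ → ℝ) (u : ℝ) (t : ℝ) : ℝ :=
  sSup (SratPow S u '' {r : ℚ | 0 ≤ r ∧ (r : ℝ) ≤ t})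

/-- A t-norm is Archimedean if for all `x, y ∈ (0,1)` there is `n` with `x_T^(n) < y`. -/
def TnormArchimedean (T : ℝ → ℝ → ℝ) : Prop :=
  ∀ x ∈ Ioo (0:ℝ) 1, ∀ y ∈ Ioo (0:ℝ) 1, ∃ n : ℕ, Tpow T x n < y

/-- Strict monotonicity of a t-norm: `T x y < T x z` whenever `x > 0` and `y < z`. -/
def TnormStrictMono (T : ℝ → ℝ → ℝ) : Prop :=
  ∀ x ∈ Icc (0:ℝ) 1, 0 < x → ∀ y ∈ Icc (0:ℝ) 1, ∀ z ∈ Icc (0:ℝ) 1, y < z → T x y < T x z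

/-- Pseudo-inverse of a decreasing `G : [0,1] → [0,∞]`:
`G^(−1)(y) = sup {x ∈ [0,1] | G x > y}`. -/
noncomputable def pseudoInv (G : ℝ → ENNReal) (y : ENNReal) : ℝ :=
  sSup {x ∈ Icc (0:ℝ) 1 | y < G x}

/-- `G : [0,1] → [0,∞]` is an additive generator of the t-norm `T`. -/
structure IsAddGen (T : ℝ → ℝ → ℝ) (G : ℝ → ENNReal) : Prop where
  strictAnti : StrictAntiOn G (Icc (0:ℝ) 1)
  rightContinuousAtZero : ContinuousWithinAt G (Icc (0:ℝ) 1) 0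
  map_one : G 1 = 0
  sum_mem : ∀ x ∈ Icc (0:ℝ) 1, ∀ y ∈ Icc (0:ℝ) 1,
    G x + G y ∈ G '' Icc (0:ℝ) 1 ∪ Icc (G 0) ⊤
  eq_pseudoInv : ∀ x ∈ Icc (0:ℝ) 1, ∀ y ∈ Icc (0:ℝ) 1, T x y = pseudoInv G (G x + G y)

namespace IsTnorm

variable {T : ℝ → ℝ → ℝ} {u : ℝ}

theorem le_left (hT : IsTnorm T) {x y : ℝ} (hx : x ∈ Icc (0:ℝ) 1) (hy : y ∈ Icc (0:ℝ) 1) :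
    T x y ≤ x :=
  (hT.mono x hx y hy 1 (by simp) hy.2).trans_eq (hT.one x hx)

theorem mono₂ (hT : IsTnorm T) {x x' y y' : ℝ} (hx : x ∈ Icc (0:ℝ) 1) (hx' : x' ∈ Icc (0:ℝ) 1)
    (hy : y ∈ Icc (0:ℝ) 1) (hy' : y' ∈ Icc (0:ℝ) 1) (hxx : x ≤ x') (hyy : y ≤ y') :
    T x y ≤ T x' y' := by
  calc T x y ≤ T x y' := hT.mono x hx y hy y' hy' hyy
    _ = T y' x := hT.comm x hx y' hy'
    _ ≤ T y' x' := hT.mono y' hy' x hx x' hx' hxx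
    _ = T x' y' := hT.comm y' hy' x' hx'

theorem zero_right (hT : IsTnorm T) {x : ℝ} (hx : x ∈ Icc (0:ℝ) 1) : T x 0 = 0 := by
  have h0 : (0:ℝ) ∈ Icc (0:ℝ) 1 := by simp
  refine le_antisymm ?_ (hT.maps_to x hx 0 h0).1
  rw [hT.comm x hx 0 h0]
  exact hT.le_left h0 hx

theorem continuousOn_right (hTc : ContinuousOn2 T) {x : ℝ} (hx : x ∈ Icc (0:ℝ) 1) :
    ContinuousOn (T x) (Icc 0 1) :=
  ContinuousOn.comp (g := fun p : ℝ × ℝ => T p.1 p.2) (f := fun y => (x, y)) hTc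
    (by fun_prop) fun _ hy => ⟨hx, hy⟩

theorem eq_of_idempotent_of_le (hT : IsTnorm T) (hTc : ContinuousOn2 T) {e x : ℝ}
    (he : e ∈ Icc (0:ℝ) 1) (hee : T e e = e) (hx : 0 ≤ x) (hxe : x ≤ e) : T x e = x := by
  obtain ⟨y, hy, rfl⟩ : x ∈ T e '' Icc 0 1 := by
    apply intermediate_value_Icc zero_le_one (continuousOn_right hTc he)
    rw [hT.zero_right he, hT.one e he]
    exact ⟨hx, hxe⟩
  rw [hT.comm _ (hT.maps_to e he y hy) e he, ← hT.assoc e he e he y hy, hee]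

theorem Tpow_mem (hT : IsTnorm T) (hu : u ∈ Icc (0:ℝ) 1) (n : ℕ) : Tpow T u n ∈ Icc (0:ℝ) 1 := by
  induction n with
  | zero => simp [Tpow]
  | succ n ih => exact hT.maps_to _ ih _ hu

theorem Tpow_add (hT : IsTnorm T) (hu : u ∈ Icc (0:ℝ) 1) (m n : ℕ) :
    Tpow T u (m + n) = T (Tpow T u m) (Tpow T u n) := by
  induction n with
  | zero => exact (hT.one _ (hT.Tpow_mem hu m)).symm
  | succ n ih =>
    change T (Tpow T u (m + n)) u = T (Tpow T u m) (T (Tpow T u n) u)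
    rw [ih, hT.assoc _ (hT.Tpow_mem hu m) _ (hT.Tpow_mem hu n) _ hu]

theorem Tpow_mul (hT : IsTnorm T) (hu : u ∈ Icc (0:ℝ) 1) (m n : ℕ) :
    Tpow T u (m * n) = Tpow T (Tpow T u m) n := by
  induction n with
  | zero => rfl
  | succ n ih => rw [Nat.mul_succ, hT.Tpow_add hu, ih]; rfl

theorem Tpow_mono (hT : IsTnorm T) {v : ℝ} (hu : u ∈ Icc (0:ℝ) 1) (hv : v ∈ Icc (0:ℝ) 1)
    (huv : u ≤ v) (n : ℕ) : Tpow T u n ≤ Tpow T v n := by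
  induction n with
  | zero => exact le_rfl
  | succ n ih => exact hT.mono₂ (hT.Tpow_mem hu n) (hT.Tpow_mem hv n) hu hv ih huv

theorem continuousOn_Tpow (hT : IsTnorm T) (hTc : ContinuousOn2 T) (n : ℕ) :
    ContinuousOn (fun v => Tpow T v n) (Icc 0 1) := by
  induction n with
  | zero => exact continuousOn_const
  | succ n ih =>
    exact ContinuousOn.comp (g := fun p : ℝ × ℝ => T p.1 p.2) (f := fun v => (Tpow T v n, v)) hTc
      (ih.prodMk continuousOn_id) fun v hv => ⟨hT.Tpow_mem hv n, hv⟩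

theorem Tpow_zero_base (hT : IsTnorm T) {n : ℕ} (hn : n ≠ 0) : Tpow T 0 n = 0 := by
  obtain ⟨n, rfl⟩ := Nat.exists_eq_succ_of_ne_zero hn
  exact hT.zero_right (hT.Tpow_mem (by simp) n)

theorem Tpow_one_base (hT : IsTnorm T) (n : ℕ) : Tpow T 1 n = 1 := by
  induction n with
  | zero => rfl
  | succ n ih => exact (congrArg (T · 1) ih).trans (hT.one 1 (by simp))

theorem exists_Tpow_eq (hT : IsTnorm T) (hTc : ContinuousOn2 T) (hu : u ∈ Icc (0:ℝ) 1) {p : ℕ}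
    (hp : p ≠ 0) : ∃ v ∈ Icc (0:ℝ) 1, Tpow T v p = u := by
  have := intermediate_value_Icc zero_le_one (hT.continuousOn_Tpow hTc p)
  rw [hT.Tpow_zero_base hp, hT.Tpow_one_base] at this
  exact this hu

theorem _root_.Troot_mem (T : ℝ → ℝ → ℝ) (u : ℝ) (p : ℕ) : Troot T u p ∈ Icc (0:ℝ) 1 :=
  ⟨Real.sSup_nonneg fun _ hv => hv.1.1, Real.sSup_le (fun _ hv => hv.1.2) zero_le_one⟩

theorem Troot_le (hT : IsTnorm T) {v : ℝ} {p : ℕ} (hv : v ∈ Icc (0:ℝ) 1)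
    (h : u ≤ Tpow T v p) : Troot T u p ≤ v := by
  refine Real.sSup_le (fun w hw => ?_) hv.1
  by_contra! hlt
  exact absurd (hT.Tpow_mono hv hw.1 hlt.le p) (not_le.2 (hw.2.trans_le h))

theorem Tpow_Troot (hT : IsTnorm T) (hTc : ContinuousOn2 T) (hu : u ∈ Icc (0:ℝ) 1) {p : ℕ}
    (hp : p ≠ 0) : Tpow T (Troot T u p) p = u := by
  have hw := Troot_mem T u p
  apply le_antisymm
  · obtain ⟨v, hv, hvu⟩ := hT.exists_Tpow_eq hTc hu hp
    rw [← hvu]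
    exact hT.Tpow_mono (Troot_mem _ _ _) hv (hT.Troot_le hv (by rw [hvu])) p
  · by_contra! hlt
    have hc := (hT.continuousOn_Tpow hTc p).mono (Icc_subset_Icc_left hw.1)
    have hmem : (Tpow T (Troot T u p) p + u) / 2 ∈
        Icc (Tpow T (Troot T u p) p) (Tpow T 1 p) := by
      rw [hT.Tpow_one_base]
      constructor <;> linarith [hu.2]
    obtain ⟨x, hx, hxe⟩ := intermediate_value_Icc hw.2 hc hmem
    simp only at hxe
    have hxw : x ≤ Troot T u p :=
      le_csSup ⟨1, fun _ hv => hv.1.2⟩ ⟨⟨hw.1.trans hx.1, hx.2⟩, by linarith⟩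
    rw [le_antisymm hxw hx.1] at hxe
    linarith

theorem Tpow_Troot_mul (hT : IsTnorm T) (hTc : ContinuousOn2 T) (hu : u ∈ Icc (0:ℝ) 1)
    {p k : ℕ} (hp : p ≠ 0) (hk : k ≠ 0) : Tpow T (Troot T u (p * k)) k = Troot T u p := by
  have ha := Troot_mem T u (p * k)
  apply le_antisymm
  · obtain ⟨c, hc, hcb⟩ := hT.exists_Tpow_eq hTc (Troot_mem T u p) hk
    rw [← hcb]
    refine hT.Tpow_mono ha hc (hT.Troot_le hc ?_) k
    rw [mul_comm, hT.Tpow_mul hc, hcb, hT.Tpow_Troot hTc hu hp]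
  · refine hT.Troot_le (hT.Tpow_mem ha k) ?_
    rw [← hT.Tpow_mul ha, mul_comm k p, hT.Tpow_Troot hTc hu (mul_ne_zero hp hk)]

theorem Tpow_Troot_eq (hT : IsTnorm T) (hTc : ContinuousOn2 T) (hu : u ∈ Icc (0:ℝ) 1)
    {p p' q q' : ℕ} (hp : p ≠ 0) (hp' : p' ≠ 0) (h : p' * q = p * q') :
    Tpow T (Troot T u p) q = Tpow T (Troot T u p') q' := by
  rw [← hT.Tpow_Troot_mul hTc hu hp hp', ← hT.Tpow_Troot_mul hTc hu hp' hp,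
    mul_comm p' p, ← hT.Tpow_mul (Troot_mem _ _ _), ← hT.Tpow_mul (Troot_mem _ _ _), h]

theorem TratPow_eq (hT : IsTnorm T) (hTc : ContinuousOn2 T) (hu : u ∈ Icc (0:ℝ) 1)
    {p q : ℕ} {r : ℚ} (hr : 0 ≤ r) (hp : p ≠ 0) (h : r * p = q) :
    TratPow T u r = Tpow T (Troot T u p) q := by
  refine hT.Tpow_Troot_eq hTc hu r.den_nz hp ?_
  have hn : ((r.num.toNat : ℕ) : ℚ) = r.num := by
    exact_mod_cast Int.toNat_of_nonneg (Rat.num_nonneg.2 hr)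
  have hd : r * r.den = r.num := Rat.mul_den_eq_num r
  have : ((p * r.num.toNat : ℕ) : ℚ) = (r.den * q : ℕ) := by
    push_cast
    rw [hn, ← hd, ← h]
    ring
  exact_mod_cast this

theorem TratPow_add (hT : IsTnorm T) (hTc : ContinuousOn2 T) (hu : u ∈ Icc (0:ℝ) 1)
    {r s : ℚ} (hr : 0 ≤ r) (hs : 0 ≤ s) :
    TratPow T u (r + s) = T (TratPow T u r) (TratPow T u s) := by
  have hp : r.den * s.den ≠ 0 := mul_ne_zero r.den_nz s.den_nz
  have hn : ∀ {x : ℚ}, 0 ≤ x → x * x.den = x.num.toNat := fun {x} hx => by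
    rw [Rat.mul_den_eq_num]
    exact_mod_cast (Int.toNat_of_nonneg (Rat.num_nonneg.2 hx)).symm
  have h1 : r * (r.den * s.den : ℕ) = (r.num.toNat * s.den : ℕ) := by
    push_cast
    rw [← hn hr]
    ring
  have h2 : s * (r.den * s.den : ℕ) = (s.num.toNat * r.den : ℕ) := by
    push_cast
    rw [← hn hs]
    ring
  rw [hT.TratPow_eq hTc hu hr hp h1, hT.TratPow_eq hTc hu hs hp h2,
    ← hT.Tpow_add (Troot_mem _ _ _)]
  refine hT.TratPow_eq hTc hu (add_nonneg hr hs) hp ?_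
  rw [add_mul, h1, h2]
  push_cast
  rfl

theorem TratPow_mem (hT : IsTnorm T) (u : ℝ) (r : ℚ) : TratPow T u r ∈ Icc (0:ℝ) 1 :=
  hT.Tpow_mem (Troot_mem _ _ _) _

theorem TratPow_anti (hT : IsTnorm T) (hTc : ContinuousOn2 T) (hu : u ∈ Icc (0:ℝ) 1)
    {r s : ℚ} (hr : 0 ≤ r) (hrs : r ≤ s) : TratPow T u s ≤ TratPow T u r := by
  rw [← add_sub_cancel r s, hT.TratPow_add hTc hu hr (sub_nonneg.2 hrs)]
  exact hT.le_left (hT.TratPow_mem u r) (hT.TratPow_mem u _)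

/-- A lower bound for the powers `u_T^(r)` with `0 ≤ r < q` is a lower bound for `u_T^(q)`,
which expresses left continuity of the rational powers. -/
theorem le_TratPow_of_forall_lt (hT : IsTnorm T) (hTc : ContinuousOn2 T)
    (hu : u ∈ Icc (0:ℝ) 1) {q : ℚ} (hq : 0 < q) {x : ℝ} (hx : x ∈ Icc (0:ℝ) 1)
    (h : ∀ r : ℚ, 0 ≤ r → r < q → x ≤ TratPow T u r) : x ≤ TratPow T u q := by
  set A : Set ℝ := TratPow T u '' Ioo 0 q with hA
  have hne : A.Nonempty := ⟨_, q / 2, ⟨by linarith, by linarith⟩, rfl⟩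
  have hsub : A ⊆ Icc 0 1 := by
    rintro _ ⟨r, -, rfl⟩
    exact hT.TratPow_mem u r
  have hbdd : BddAbove A := ⟨1, fun y hy => (hsub hy).2⟩
  have hcl : sSup A ∈ closure A := csSup_mem_closure hne hbdd
  have he : sSup A ∈ Icc (0:ℝ) 1 := closure_minimal hsub isClosed_Icc hcl
  have hle : ∀ r : ℚ, 0 < r → r < q → TratPow T u r ≤ sSup A := fun r h0 h1 =>
    le_csSup hbdd ⟨r, ⟨h0, h1⟩, rfl⟩
  have hee : T (sSup A) (sSup A) = sSup A := by
    refine le_antisymm (hT.le_left he he) (csSup_le hne ?_)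
    rintro _ ⟨r, ⟨h0, h1⟩, rfl⟩
    rw [← add_halves r, hT.TratPow_add hTc hu (by linarith) (by linarith)]
    have := hle (r / 2) (by linarith) (by linarith)
    exact hT.mono₂ (hT.TratPow_mem u _) he (hT.TratPow_mem u _) he this this
  have hxe : x ≤ sSup A :=
    (h (q / 2) (by linarith) (by linarith)).trans (hle _ (by linarith) (by linarith))
  rw [← hT.eq_of_idempotent_of_le hTc he hee hx.1 hxe]
  have hmaps : MapsTo (T x) A (Iic (TratPow T u q)) := by
    rintro _ ⟨r, ⟨h0, h1⟩, rfl⟩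
    rw [mem_Iic, ← sub_add_cancel q r, hT.TratPow_add hTc hu (by linarith) h0.le]
    exact hT.mono₂ hx (hT.TratPow_mem u _) (hT.TratPow_mem u _) (hT.TratPow_mem u _)
      (h _ (by linarith) (by linarith)) le_rfl
  have := ((continuousOn_right hTc hx) _ he).mono hsub |>.mem_closure hcl hmaps
  rwa [closure_Iic] at this

theorem nonempty_TrePow (T : ℝ → ℝ → ℝ) (u : ℝ) {t : ℝ} (ht : 0 ≤ t) :
    (TratPow T u '' {r : ℚ | 0 ≤ r ∧ (r : ℝ) ≤ t}).Nonempty :=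
  ⟨_, 0, ⟨le_rfl, by simpa using ht⟩, rfl⟩

theorem subset_TrePow (hT : IsTnorm T) (u t : ℝ) :
    TratPow T u '' {r : ℚ | 0 ≤ r ∧ (r : ℝ) ≤ t} ⊆ Icc 0 1 := by
  rintro _ ⟨r, -, rfl⟩
  exact hT.TratPow_mem u r

theorem bddBelow_TrePow (hT : IsTnorm T) (u t : ℝ) :
    BddBelow (TratPow T u '' {r : ℚ | 0 ≤ r ∧ (r : ℝ) ≤ t}) :=
  bddBelow_Icc.mono (hT.subset_TrePow u t)

theorem TrePow_mem_closure (hT : IsTnorm T) (u : ℝ) {t : ℝ} (ht : 0 ≤ t) :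
    TrePow T u t ∈ closure (TratPow T u '' {r : ℚ | 0 ≤ r ∧ (r : ℝ) ≤ t}) :=
  csInf_mem_closure (nonempty_TrePow T u ht) (hT.bddBelow_TrePow u t)

theorem TrePow_mem (hT : IsTnorm T) (u : ℝ) {t : ℝ} (ht : 0 ≤ t) :
    TrePow T u t ∈ Icc (0:ℝ) 1 :=
  closure_minimal (hT.subset_TrePow u t) isClosed_Icc (hT.TrePow_mem_closure u ht)

theorem TrePow_le (hT : IsTnorm T) (u : ℝ) {t : ℝ} {r : ℚ} (hr : 0 ≤ r) (hrt : (r : ℝ) ≤ t) :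
    TrePow T u t ≤ TratPow T u r :=
  csInf_le (hT.bddBelow_TrePow u t) ⟨r, ⟨hr, hrt⟩, rfl⟩

theorem TrePow_anti (hT : IsTnorm T) (u : ℝ) {s t : ℝ} (hs : 0 ≤ s) (hst : s ≤ t) :
    TrePow T u t ≤ TrePow T u s :=
  csInf_le_csInf (hT.bddBelow_TrePow u t) (nonempty_TrePow T u hs)
    (image_mono fun _ hr => ⟨hr.1, hr.2.trans hst⟩)

theorem TrePow_add (hT : IsTnorm T) (hTc : ContinuousOn2 T) (hu : u ∈ Icc (0:ℝ) 1)
    {t₁ t₂ : ℝ} (h₁ : 0 < t₁) (h₂ : 0 < t₂) :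
    T (TrePow T u t₁) (TrePow T u t₂) = TrePow T u (t₁ + t₂) := by
  have hm₁ := hT.TrePow_mem u h₁.le
  have hm₂ := hT.TrePow_mem u h₂.le
  have hm := hT.maps_to _ hm₁ _ hm₂
  apply le_antisymm
  · have key : ∀ q : ℚ, 0 ≤ q → (q : ℝ) < t₁ + t₂ →
        T (TrePow T u t₁) (TrePow T u t₂) ≤ TratPow T u q := by
      intro q hq hqt
      obtain ⟨r, hr0, hrq, hr₁, hr₂⟩ :
          ∃ r : ℚ, 0 ≤ r ∧ r ≤ q ∧ (r : ℝ) ≤ t₁ ∧ (q : ℝ) - r ≤ t₂ := by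
        have hq' : (0:ℝ) ≤ q := by exact_mod_cast hq
        rcases le_or_gt (q : ℝ) t₂ with h | h
        · exact ⟨0, le_rfl, hq, by simpa using h₁.le, by simpa using h⟩
        · obtain ⟨r, hr, hr'⟩ := exists_rat_btwn
            (show (q : ℝ) - t₂ < min (q : ℝ) t₁ from lt_min (by linarith) (by linarith))
          have hrq := hr'.trans_le (min_le_left _ _)
          have hrt := hr'.trans_le (min_le_right _ _)
          exact ⟨r, by exact_mod_cast (show (0:ℝ) ≤ r by linarith), by exact_mod_cast hrq.le,
            hrt.le, by linarith⟩
      rw [← add_sub_cancel r q, hT.TratPow_add hTc hu hr0 (sub_nonneg.2 hrq)]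
      exact hT.mono₂ hm₁ (hT.TratPow_mem u _) hm₂ (hT.TratPow_mem u _) (hT.TrePow_le u hr0 hr₁)
        (hT.TrePow_le u (sub_nonneg.2 hrq) (by push_cast; exact hr₂))
    refine le_csInf (nonempty_TrePow T u (by linarith)) ?_
    rintro _ ⟨q, ⟨hq, hqt⟩, rfl⟩
    rcases hq.eq_or_lt with rfl | hq
    · exact key 0 le_rfl (by simp; linarith)
    · refine hT.le_TratPow_of_forall_lt hTc hu hq hm fun r hr hrq => key r hr ?_
      exact lt_of_lt_of_le (by exact_mod_cast hrq) hqt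
  · have hcl : (TrePow T u t₁, TrePow T u t₂) ∈ closure
        ((TratPow T u '' {r : ℚ | 0 ≤ r ∧ (r : ℝ) ≤ t₁}) ×ˢ
          (TratPow T u '' {r : ℚ | 0 ≤ r ∧ (r : ℝ) ≤ t₂})) := by
      rw [closure_prod_eq]
      exact ⟨hT.TrePow_mem_closure u h₁.le, hT.TrePow_mem_closure u h₂.le⟩
    have hcw := (hTc (TrePow T u t₁, TrePow T u t₂) ⟨hm₁, hm₂⟩).mono
      (prod_mono (hT.subset_TrePow u t₁) (hT.subset_TrePow u t₂))
    have := hcw.mem_closure (t := Ici (TrePow T u (t₁ + t₂))) hcl ?_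
    · rwa [closure_Ici] at this
    · rintro ⟨_, _⟩ ⟨⟨r, ⟨hr, hrt⟩, rfl⟩, ⟨s, ⟨hs, hst⟩, rfl⟩⟩
      simp only [mem_Ici]
      rw [← hT.TratPow_add hTc hu hr hs]
      exact hT.TrePow_le u (add_nonneg hr hs) (by push_cast; linarith)

end IsTnorm

/-- The operation dual to `S` under the reflection `x ↦ 1 - x`. -/
def dualOp (S : ℝ → ℝ → ℝ) (x y : ℝ) : ℝ := 1 - S (1 - x) (1 - y)

theorem one_sub_mem_Icc {x : ℝ} (hx : x ∈ Icc (0:ℝ) 1) : 1 - x ∈ Icc (0:ℝ) 1 :=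
  ⟨by linarith [hx.2], by linarith [hx.1]⟩

theorem IsTconorm.isTnorm_dualOp {S : ℝ → ℝ → ℝ} (hS : IsTconorm S) : IsTnorm (dualOp S) where
  maps_to x hx y hy :=
    one_sub_mem_Icc (hS.maps_to _ (one_sub_mem_Icc hx) _ (one_sub_mem_Icc hy))
  comm x hx y hy := by
    simp only [dualOp, hS.comm _ (one_sub_mem_Icc hx) _ (one_sub_mem_Icc hy)]
  assoc x hx y hy z hz := by
    simp only [dualOp, sub_sub_cancel,
      hS.assoc _ (one_sub_mem_Icc hx) _ (one_sub_mem_Icc hy) _ (one_sub_mem_Icc hz)]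
  mono x hx y hy z hz hyz :=
    sub_le_sub_left (hS.mono _ (one_sub_mem_Icc hx) _ (one_sub_mem_Icc hz) _
      (one_sub_mem_Icc hy) (by linarith)) 1
  one x hx := by
    simp only [dualOp, sub_self, hS.zero _ (one_sub_mem_Icc hx), sub_sub_cancel]

theorem ContinuousOn2.dualOp {S : ℝ → ℝ → ℝ} (hS : ContinuousOn2 S) :
    ContinuousOn2 (dualOp S) := by
  refine continuousOn_const.sub (ContinuousOn.comp (g := fun p : ℝ × ℝ => S p.1 p.2)
    (f := fun p : ℝ × ℝ => (1 - p.1, 1 - p.2)) hS (by fun_prop) ?_)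
  exact fun p hp => ⟨one_sub_mem_Icc hp.1, one_sub_mem_Icc hp.2⟩

theorem Spow_eq_dualOp (S : ℝ → ℝ → ℝ) (v : ℝ) (n : ℕ) :
    Spow S v n = 1 - Tpow (dualOp S) (1 - v) n := by
  induction n with
  | zero => simp [Spow, Tpow]
  | succ n ih => simp [Spow, Tpow, dualOp, ih]

theorem Real.sSup_image_one_sub {A : Set ℝ} (hne : A.Nonempty) (hb : BddBelow A) :
    sSup ((fun x => 1 - x) '' A) = 1 - sInf A :=
  (Antitone.map_csInf_of_continuousAt (f := fun x : ℝ => 1 - x) (by fun_prop)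
    (fun _ _ h => sub_le_sub_left h 1) hne hb).symm

theorem Real.sInf_image_one_sub {A : Set ℝ} (hne : A.Nonempty) (hb : BddAbove A) :
    sInf ((fun x => 1 - x) '' A) = 1 - sSup A :=
  (Antitone.map_csSup_of_continuousAt (f := fun x : ℝ => 1 - x) (by fun_prop)
    (fun _ _ h => sub_le_sub_left h 1) hne hb).symm

namespace IsTconorm

variable {S : ℝ → ℝ → ℝ} {u : ℝ}

theorem Sroot_eq_dualOp (hS : IsTconorm S) (hu : u < 1) {p : ℕ} (hp : p ≠ 0) :
    Sroot S u p = 1 - Troot (dualOp S) (1 - u) p := by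
  rw [Sroot, Troot, ← Real.sInf_image_one_sub
    (A := {v ∈ Icc (0:ℝ) 1 | Tpow (dualOp S) v p < 1 - u})
    ⟨0, by simp, by rw [hS.isTnorm_dualOp.Tpow_zero_base hp]; linarith⟩
    ⟨1, fun _ hv => hv.1.2⟩]
  congr 1
  ext v
  simp only [mem_image, mem_ofPred_eq, Spow_eq_dualOp]
  constructor
  · rintro ⟨hv, h⟩
    exact ⟨1 - v, ⟨one_sub_mem_Icc hv, by linarith⟩, by ring⟩
  · rintro ⟨w, ⟨hw, h⟩, rfl⟩
    exact ⟨one_sub_mem_Icc hw, by rw [sub_sub_cancel]; linarith⟩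

theorem SratPow_eq_dualOp (hS : IsTconorm S) (hu : u < 1) (r : ℚ) :
    SratPow S u r = 1 - TratPow (dualOp S) (1 - u) r := by
  rw [SratPow, TratPow, Spow_eq_dualOp, hS.Sroot_eq_dualOp hu r.den_nz, sub_sub_cancel]

theorem SrePow_eq_dualOp (hS : IsTconorm S) (hu : u < 1) {t : ℝ} (ht : 0 ≤ t) :
    SrePow S u t = 1 - TrePow (dualOp S) (1 - u) t := by
  rw [SrePow, TrePow, ← Real.sSup_image_one_sub (IsTnorm.nonempty_TrePow _ _ ht)
    (hS.isTnorm_dualOp.bddBelow_TrePow _ _), image_image]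
  simp only [hS.SratPow_eq_dualOp hu]

/-- The set defining `Sroot S 1 p` is empty and the infimum of the empty set of reals is `0`,
so every real power of `1` is `0`. -/
theorem SrePow_one (hS : IsTconorm S) {t : ℝ} (ht : 0 ≤ t) : SrePow S 1 t = 0 := by
  have hroot (p : ℕ) : Sroot S 1 p = 0 := by
    rw [Sroot, show {v ∈ Icc (0:ℝ) 1 | 1 < Spow S v p} = ∅ from ?_, Real.sInf_empty]
    refine eq_empty_of_forall_notMem fun v hv => ?_
    have h := hv.2
    rw [Spow_eq_dualOp] at h
    linarith [(hS.isTnorm_dualOp.Tpow_mem (one_sub_mem_Icc hv.1) p).1]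
  have hrat (r : ℚ) : SratPow S 1 r = 0 := by
    rw [SratPow, hroot, Spow_eq_dualOp, sub_zero, hS.isTnorm_dualOp.Tpow_one_base, sub_self]
  have hne : {r : ℚ | 0 ≤ r ∧ (r : ℝ) ≤ t}.Nonempty := ⟨0, le_rfl, by simpa using ht⟩
  rw [SrePow, funext hrat, hne.image_const, csSup_singleton]

theorem SrePow_add (hS : IsTconorm S) (hSc : ContinuousOn2 S) (hu : u ∈ Icc (0:ℝ) 1)
    {t₁ t₂ : ℝ} (h₁ : 0 < t₁) (h₂ : 0 < t₂) :
    S (SrePow S u t₁) (SrePow S u t₂) = SrePow S u (t₁ + t₂) := by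
  rcases hu.2.eq_or_lt with rfl | hu1
  · rw [hS.SrePow_one h₁.le, hS.SrePow_one h₂.le, hS.SrePow_one (by linarith),
      hS.zero 0 (by simp)]
  · have := hS.isTnorm_dualOp.TrePow_add hSc.dualOp (one_sub_mem_Icc hu) h₁ h₂
    rw [hS.SrePow_eq_dualOp hu1 h₁.le, hS.SrePow_eq_dualOp hu1 h₂.le,
      hS.SrePow_eq_dualOp hu1 (by linarith), ← this]
    exact (sub_sub_cancel _ _).symm

theorem SrePow_mono (hS : IsTconorm S) (hu : u ≤ 1) {s t : ℝ} (hs : 0 ≤ s) (hst : s ≤ t) :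
    SrePow S u s ≤ SrePow S u t := by
  rcases hu.eq_or_lt with rfl | hu1
  · rw [hS.SrePow_one hs, hS.SrePow_one (hs.trans hst)]
  · rw [hS.SrePow_eq_dualOp hu1 hs, hS.SrePow_eq_dualOp hu1 (hs.trans hst)]
    exact sub_le_sub_left (hS.isTnorm_dualOp.TrePow_anti _ hs hst) 1

end IsTconorm

/-- For a continuous t-norm `T` and continuous t-conorm `S`,
`T(u_T^(t₁), u_T^(t₂)) = u_T^(t₁+t₂)` and `S(u_S^(t₁), u_S^(t₂)) = u_S^(t₁+t₂)`;
in particular `t ↦ u_T^(t)` is nonincreasing and `t ↦ u_S^(t)` is nondecreasing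
on `(0,∞)`. -/
theorem tnorm_tconorm_pow_add (T S : ℝ → ℝ → ℝ) (hT : IsTnorm T) (hTc : ContinuousOn2 T)
    (hS : IsTconorm S) (hSc : ContinuousOn2 S) :
    ∀ u ∈ Icc (0:ℝ) 1,
      (∀ t₁ t₂ : ℝ, 0 < t₁ → 0 < t₂ →
        T (TrePow T u t₁) (TrePow T u t₂) = TrePow T u (t₁ + t₂) ∧
        S (SrePow S u t₁) (SrePow S u t₂) = SrePow S u (t₁ + t₂)) ∧
      AntitoneOn (fun t => TrePow T u t) (Ioi (0:ℝ)) ∧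
      MonotoneOn (fun t => SrePow S u t) (Ioi (0:ℝ)) := by
  exact fun u hu =>
    ⟨fun t₁ t₂ h₁ h₂ => ⟨hT.TrePow_add hTc hu h₁ h₂, hS.SrePow_add hSc hu h₁ h₂⟩,
      fun _ hs _ _ hst => hT.TrePow_anti u (le_of_lt hs) hst,
      fun _ hs _ _ hst => hS.SrePow_mono hu.2 (le_of_lt hs) hst⟩
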